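/- Let r be a positive integer and fix α ∈ (0,1). Let F be the cumulative distribution function of Z/√U, where Z is standard normal and U ~ χ²_r are independent. For reals x and w > 0, define pl(x,w; t) = min{1, 2(1 − F(x/√w))} if t = 0, and pl(x,w; t) = 1 − |2F((x−t)/√w) − 1| if t > 0. Then for every θ ≥ 0 and every σ > 0, if X = θ + σZ and W = σ²U with Z standard normal and U ~ χ²_r independent, the IM confidence set {t ≥ 0 : pl(X,W; t) > α} covers θ with probability at least 1−α: P{pl(X,W; θ) > α} ≥ 1−α, with equality P{pl(X,W; θ) > α} = 1−α whenever θ > 0. -/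

import Mathlib

open MeasureTheory ProbabilityTheory Real

/-- The joint law of `(Z, U)` with `Z ~ N(0,1)` and `U ~ χ²_r` independent. -/
noncomputable def jointZU (r : ℕ) : Measure (ℝ × ℝ) :=
  (gaussianReal 0 1).prod (gammaMeasure ((r : ℝ) / 2) (1 / 2))

/-- The CDF `F` of the pivot `Z/√U`. -/
noncomputable def pivotCDF (r : ℕ) : ℝ → ℝ :=
  cdf (Measure.map (fun p : ℝ × ℝ => p.1 / Real.sqrt p.2) (jointZU r))

/-- The IM plausibility of the singleton assertion `{θ = t}` at data `(x, w)`: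
`pl(x,w;t) = min{1, 2(1 − F(x/√w))}` if `t = 0`, and
`pl(x,w;t) = 1 − |2F((x−t)/√w) − 1|` if `t > 0`. -/
noncomputable def imPl (r : ℕ) (x w t : ℝ) : ℝ :=
  if t = 0 then min 1 (2 * (1 - pivotCDF r (x / Real.sqrt w)))
  else 1 - |2 * pivotCDF r ((x - t) / Real.sqrt w) - 1|



lemma cdf_continuous_aux (ν : Measure ℝ) [IsProbabilityMeasure ν] [NullSingletonClass ν] :
    Continuous (cdf ν) := by
  rw [continuous_iff_continuousAt]
  intro x
  rw [(monotone_cdf ν).continuousAt_iff_leftLim_eq_rightLim, StieltjesFunction.rightLim_eq]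
  have h : (cdf ν).measure {x} = 0 := by rw [measure_cdf]; simp
  rw [StieltjesFunction.measure_singleton, ENNReal.ofReal_eq_zero] at h
  exact le_antisymm ((monotone_cdf ν).leftLim_le le_rfl) (by linarith)

lemma cdf_exists_aux (ν : Measure ℝ) [IsProbabilityMeasure ν] [NullSingletonClass ν] (a : ℝ)
    (ha : a ∈ Set.Ioo (0 : ℝ) 1) : ∃ c, cdf ν c = a := by
  obtain ⟨x, hx⟩ := ((tendsto_cdf_atBot ν).eventually (gt_mem_nhds ha.1)).exists
  obtain ⟨y, hy⟩ := ((tendsto_cdf_atTop ν).eventually (lt_mem_nhds ha.2)).exists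
  exact mem_range_of_exists_le_of_exists_ge (cdf_continuous_aux ν) ⟨x, hx.le⟩ ⟨y, hy.le⟩

lemma cdf_lt_le_aux (ν : Measure ℝ) [IsProbabilityMeasure ν] [NullSingletonClass ν] (a : ℝ)
    (ha : a ∈ Set.Ioo (0 : ℝ) 1) :
    ν.real {x | cdf ν x < a} ≤ a ∧ a ≤ ν.real {x | cdf ν x ≤ a} := by
  obtain ⟨c, hc⟩ := cdf_exists_aux ν a ha
  have h : ν.real (Set.Iic c) = a := by rw [← cdf_eq_real, hc]
  constructor
  · rw [← h]
    refine measureReal_mono (fun x hx => ?_)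
    rw [Set.mem_setOf_eq, h, ← hc] at hx
    exact ((monotone_cdf ν).reflect_lt hx).le
  · nth_rw 1 [← h]
    refine measureReal_mono (fun x hx => ?_)
    rw [Set.mem_setOf_eq, ← hc]
    exact monotone_cdf ν hx

lemma cdf_lt_eq_aux (ν : Measure ℝ) [IsProbabilityMeasure ν] [NullSingletonClass ν] (a : ℝ)
    (ha : a ∈ Set.Ioo (0 : ℝ) 1) :
    ν.real {x | cdf ν x < a} = a ∧ ν.real {x | cdf ν x ≤ a} = a := by
  obtain ⟨h1, h2⟩ := cdf_lt_le_aux ν a ha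
  refine ⟨le_antisymm h1 ?_, le_antisymm ?_ h2⟩
  · refine le_of_forall_lt_imp_le_of_dense (fun b hb => ?_)
    by_cases hb0 : 0 < b
    · refine (cdf_lt_le_aux ν b ⟨hb0, hb.trans ha.2⟩).2.trans (measureReal_mono fun x hx => ?_)
      exact lt_of_le_of_lt hx hb
    · exact (not_lt.mp hb0).trans measureReal_nonneg
  · refine le_of_forall_gt_imp_ge_of_dense (fun b hb => ?_)
    by_cases hb1 : b < 1
    · refine le_trans (measureReal_mono fun x hx => ?_) (cdf_lt_le_aux ν b ⟨ha.1.trans hb, hb1⟩).1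
      exact lt_of_le_of_lt hx hb
    · exact measureReal_le_one.trans (not_lt.mp hb1)

lemma pivot_measurable_aux : Measurable (fun p : ℝ × ℝ => p.1 / Real.sqrt p.2) := by
  fun_prop

lemma gamma_prob_aux (r : ℕ) (hr : 0 < r) :
    IsProbabilityMeasure (gammaMeasure ((r : ℝ) / 2) (1 / 2)) :=
  isProbabilityMeasure_gammaMeasure (by positivity) (by norm_num)

lemma gamma_pos_aux (r : ℕ) :
    ∀ᵐ u ∂(gammaMeasure ((r : ℝ) / 2) (1 / 2)), 0 < u := by
  rw [ae_iff]
  have : {u : ℝ | ¬ 0 < u} = Set.Iic 0 := by ext; simp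
  rw [this, gammaMeasure, withDensity_apply _ measurableSet_Iic,
    setLIntegral_congr (Iio_ae_eq_Iic (a := (0:ℝ))).symm]
  exact lintegral_gammaPDF_of_nonpos le_rfl

lemma pivot_noAtoms_aux (r : ℕ) (hr : 0 < r) :
    NullSingletonClass (Measure.map (fun p : ℝ × ℝ => p.1 / Real.sqrt p.2) (jointZU r)) := by
  have := gamma_prob_aux r hr
  have : NullSingletonClass (gaussianReal 0 1) := nullSingletonClass_gaussianReal one_ne_zero
  refine ⟨fun c => ?_⟩
  rw [Measure.map_apply pivot_measurable_aux (measurableSet_singleton c), jointZU,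
    Measure.prod_apply_symm (pivot_measurable_aux (measurableSet_singleton c)),
    lintegral_eq_zero_iff']
  · filter_upwards [gamma_pos_aux r] with u hu
    have hs := Real.sqrt_pos.mpr hu
    refine measure_mono_null (t := {c * Real.sqrt u}) (fun z hz => ?_) (measure_singleton _)
    have hz' : z / Real.sqrt u = c := hz
    rw [Set.mem_singleton_iff, ← hz']
    field_simp
  · exact (measurable_measure_prodMk_right
      (pivot_measurable_aux (measurableSet_singleton c))).aemeasurable

/-- **Coverage of the IM confidence set in the constrained normal model.**
For every `θ ≥ 0` and `σ > 0`, with `X = θ + σZ` and `W = σ²U`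
(`Z ~ N(0,1)`, `U ~ χ²_r` independent), the IM confidence set
`{t ≥ 0 : pl(X,W;t) > α}` covers `θ` with probability at least `1 − α`, with exact
equality whenever `θ > 0`. -/
theorem im_confidence_set_coverage (r : ℕ) (hr : 0 < r)
    (α : ℝ) (hα : α ∈ Set.Ioo (0 : ℝ) 1)
    (θ σ : ℝ) (hθ : 0 ≤ θ) (hσ : 0 < σ) :
    ENNReal.ofReal (1 - α) ≤
      jointZU r {p | α < imPl r (θ + σ * p.1) (σ ^ 2 * p.2) θ} ∧
    (0 < θ →
      jointZU r {p | α < imPl r (θ + σ * p.1) (σ ^ 2 * p.2) θ} =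
        ENNReal.ofReal (1 - α)) := by
  have hg := gamma_prob_aux r hr
  have hprob : IsProbabilityMeasure (jointZU r) := by unfold jointZU; infer_instance
  set ν := Measure.map (fun p : ℝ × ℝ => p.1 / Real.sqrt p.2) (jointZU r) with hν
  have hνp : IsProbabilityMeasure ν :=
    Measure.isProbabilityMeasure_map pivot_measurable_aux.aemeasurable
  have hνa : NullSingletonClass ν := pivot_noAtoms_aux r hr
  obtain ⟨hα0, hα1⟩ := hα
  have hm : Measurable (cdf ν) := (monotone_cdf ν).measurable
  have hpiv : ∀ p : ℝ × ℝ, (σ * p.1) / Real.sqrt (σ ^ 2 * p.2) = p.1 / Real.sqrt p.2 := by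
    intro p
    rw [Real.sqrt_mul (sq_nonneg σ), Real.sqrt_sq hσ.le, mul_div_mul_left _ _ hσ.ne']
  have hF : pivotCDF r = cdf ν := rfl
  have hL := (cdf_lt_eq_aux ν (1 - α / 2) ⟨by linarith, by linarith⟩).1
  have hR := (cdf_lt_eq_aux ν (α / 2) ⟨by linarith, by linarith⟩).2
  have hmL : MeasurableSet {x | cdf ν x < 1 - α / 2} := measurableSet_lt hm measurable_const
  have hmR : MeasurableSet {x | cdf ν x ≤ α / 2} := measurableSet_le hm measurable_const
  have hpos : 0 < θ →
      jointZU r {p | α < imPl r (θ + σ * p.1) (σ ^ 2 * p.2) θ} = ENNReal.ofReal (1 - α) := by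
    intro h
    have hset : {p : ℝ × ℝ | α < imPl r (θ + σ * p.1) (σ ^ 2 * p.2) θ} =
        (fun p : ℝ × ℝ => p.1 / Real.sqrt p.2) ⁻¹'
          ({x | cdf ν x < 1 - α / 2} \ {x | cdf ν x ≤ α / 2}) := by
      ext p
      simp only [Set.mem_setOf_eq, Set.mem_preimage, Set.mem_diff, imPl, if_neg h.ne',
        add_sub_cancel_left, hpiv, hF, not_le]
      rw [lt_sub_comm, abs_lt]
      constructor
      · rintro ⟨h1, h2⟩; constructor <;> linarith
      · rintro ⟨h1, h2⟩; constructor <;> linarith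
    rw [hset, ← Measure.map_apply pivot_measurable_aux (hmL.diff hmR), ← hν,
      ← ofReal_measureReal, measureReal_diff _ hmR, hL, hR]
    · congr 1; ring
    · intro x hx
      have hx' : cdf ν x ≤ α / 2 := hx
      show cdf ν x < 1 - α / 2
      linarith
  refine ⟨?_, hpos⟩
  rcases hθ.eq_or_lt with h | h
  · subst h
    have hset : {p : ℝ × ℝ | α < imPl r (0 + σ * p.1) (σ ^ 2 * p.2) 0} =
        (fun p : ℝ × ℝ => p.1 / Real.sqrt p.2) ⁻¹' {x | cdf ν x < 1 - α / 2} := by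
      ext p
      simp only [Set.mem_setOf_eq, Set.mem_preimage, imPl, if_true, zero_add, hpiv, hF, lt_min_iff]
      constructor
      · rintro ⟨h1, h2⟩; linarith
      · intro h1; exact ⟨hα1, by linarith⟩
    rw [hset, ← Measure.map_apply pivot_measurable_aux hmL, ← hν, ← ofReal_measureReal, hL]
    exact ENNReal.ofReal_le_ofReal (by linarith)
  · exact (hpos h).ge
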